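/- arXiv:2302.01175 — 2 statements merged into one kernel-verified Lean document; each statement's English description precedes it below -/
import Mathlib

section
/- Consider the regularized Lur'e system ẋ ∈ F(x) with F(x) := {Ax + Bu : u ∈ −ΨΨ(Cx)} and suppose Assumptions 1 and 3 hold. Then the following are equivalent: (a) ker C = {0}; (b) the system is state finite-time stable, i.e., for every Krasovskii solution x : [0,∞) → ℝⁿ there exists T ∈ [0,∞) such that x(t) = 0 for all t ≥ T. -/
open Matrix MeasureTheory Filter Set
open scoped ENNReal

noncomputable section

/-- Euclidean norm on `Fin m → ℝ`. -/
def euclNorm {m : ℕ} (x : Fin m → ℝ) : ℝ := Real.sqrt (∑ i, x i ^ 2)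

/-- Krasovskii regularization of a scalar function `ψ` at `y`:
`Ψ(y) = ⋂_{δ>0} closure (convexHull (ψ '' [y-δ, y+δ]))`. -/
def kras (ψ : ℝ → ℝ) (y : ℝ) : Set ℝ :=
  ⋂ δ ∈ Set.Ioi (0 : ℝ), closure (convexHull ℝ (ψ '' Set.Icc (y - δ) (y + δ)))

/-- Product (decentralized) Krasovskii regularization `ΨΨ(y) = Ψ₁(y₁) × ⋯ × Ψ_p(y_p)`. -/
def PsiSet {p : ℕ} (ψ : Fin p → ℝ → ℝ) (y : Fin p → ℝ) : Set (Fin p → ℝ) :=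
  {w | ∀ i, w i ∈ kras (ψ i) (y i)}

/-- The regularized Lur'e set-valued dynamics `F(x) = {Ax + Bu : u ∈ -ΨΨ(Cx)}`. -/
def lureF {n p : ℕ} (A : Matrix (Fin n) (Fin n) ℝ) (B : Matrix (Fin n) (Fin p) ℝ)
    (C : Matrix (Fin p) (Fin n) ℝ) (ψ : Fin p → ℝ → ℝ) (x : Fin n → ℝ) :
    Set (Fin n → ℝ) :=
  {f | ∃ u : Fin p → ℝ, (fun i => -u i) ∈ PsiSet ψ (C.mulVec x) ∧
        f = A.mulVec x + B.mulVec u}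

/-- Piecewise continuity: finitely many discontinuity points on every compact
interval, and finite one-sided limits at every point. -/
def PiecewiseContinuous (f : ℝ → ℝ) : Prop :=
  (∀ a b : ℝ, {s ∈ Set.Icc a b | ¬ ContinuousAt f s}.Finite) ∧
  (∀ x : ℝ, (∃ L : ℝ, Tendsto f (nhdsWithin x (Set.Ioi x)) (nhds L)) ∧
    (∃ L : ℝ, Tendsto f (nhdsWithin x (Set.Iio x)) (nhds L)))

/-- Sector condition: there is `ζ = 1/z ∈ (0, +∞]` (with `z = ζ⁻¹ ≥ 0`, `z = 0`
corresponding to `ζ = +∞`) such that `ψ(s)(ψ(s) - ζ s) ≤ 0` for all `s`. -/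
def Sector (ψ : ℝ → ℝ) (z : ℝ) : Prop :=
  (z = 0 ∧ ∀ s : ℝ, 0 ≤ s * ψ s) ∨
  (0 < z ∧ ∀ s : ℝ, ψ s * (ψ s - (1 / z) * s) ≤ 0)

/-- Class `KL` functions. -/
def ClassKL (β : ℝ → ℝ → ℝ) : Prop :=
  (∀ t : ℝ, 0 ≤ t → ContinuousOn (fun s => β s t) (Set.Ici 0) ∧
    StrictMonoOn (fun s => β s t) (Set.Ici 0) ∧ β 0 t = 0) ∧
  (∀ s : ℝ, 0 ≤ s → AntitoneOn (fun t => β s t) (Set.Ici 0) ∧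
    Tendsto (fun t => β s t) atTop (nhds 0))

/-- Class `K∞` functions. -/
def ClassKInf (α : ℝ → ℝ) : Prop :=
  ContinuousOn α (Set.Ici 0) ∧ StrictMonoOn α (Set.Ici 0) ∧ α 0 = 0 ∧
  Tendsto α atTop atTop

/-- A Krasovskii solution of `ẋ ∈ F(x)` on a time set `s` (a locally absolutely
continuous function whose derivative belongs to `F(x(t))` almost everywhere),
formalized through the integral representation `x(t) = x(0) + ∫₀ᵗ f(τ) dτ`
with `f(τ) ∈ F(x(τ))` for a.e. `τ ∈ s`. -/
def IsKrasovskiiSolutionOn {n : ℕ} (F : (Fin n → ℝ) → Set (Fin n → ℝ))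
    (x : ℝ → Fin n → ℝ) (s : Set ℝ) : Prop :=
  ∃ f : ℝ → Fin n → ℝ,
    (∀ t ∈ s, IntervalIntegrable f volume 0 t) ∧
    (∀ᵐ t ∂volume, t ∈ s → f t ∈ F (x t)) ∧
    ∀ t ∈ s, x t = x 0 + ∫ τ in (0:ℝ)..t, f τ

/-- The time interval `[0, T)` with `T ∈ (0, +∞]`. -/
def timeItv (T : ℝ≥0∞) : Set ℝ := {t : ℝ | 0 ≤ t ∧ ENNReal.ofReal t < T}

/-- Global asymptotic stability of the origin: a class-`KL` bound holds along
every Krasovskii solution on every time interval `[0, T)`. -/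
def GASOrigin {n p : ℕ} (A : Matrix (Fin n) (Fin n) ℝ) (B : Matrix (Fin n) (Fin p) ℝ)
    (C : Matrix (Fin p) (Fin n) ℝ) (ψ : Fin p → ℝ → ℝ) : Prop :=
  ∃ β : ℝ → ℝ → ℝ, ClassKL β ∧
    ∀ T : ℝ≥0∞, ∀ x : ℝ → Fin n → ℝ,
      IsKrasovskiiSolutionOn (lureF A B C ψ) x (timeItv T) →
      ∀ t ∈ timeItv T, euclNorm (x t) ≤ β (euclNorm (x 0)) t

/-- If `ψ` takes values in `[l, u]` on an open interval around `y`, so does its regularization. -/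
lemma kras_subset_Icc {ψ : ℝ → ℝ} {a b l u y : ℝ} (hψ : ∀ s ∈ Ioo a b, ψ s ∈ Icc l u)
    (hy : y ∈ Ioo a b) : kras ψ y ⊆ Icc l u := by
  obtain ⟨δ, hδ, hsub⟩ := Metric.nhds_basis_closedBall.mem_iff.1 (isOpen_Ioo.mem_nhds hy)
  rw [Real.closedBall_eq_Icc] at hsub
  intro w hw
  have hw' := mem_iInter₂.1 hw δ hδ
  refine closure_minimal (convexHull_min ?_ (convex_Icc l u)) isClosed_Icc hw'
  rintro _ ⟨s, hs, rfl⟩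
  exact hψ s (hsub hs)

/-- The regularization at `0` contains the segment between the one-sided limits. -/
lemma Icc_subset_kras_zero {ψ : ℝ → ℝ} {l u : ℝ}
    (hl : Tendsto ψ (nhdsWithin 0 (Iio 0)) (nhds l))
    (hu : Tendsto ψ (nhdsWithin 0 (Ioi 0)) (nhds u)) : Icc l u ⊆ kras ψ 0 := by
  intro w hw
  refine mem_iInter₂.2 fun δ (hδ : 0 < δ) => ?_
  have hconv : Convex ℝ (closure (convexHull ℝ (ψ '' Icc (0 - δ) (0 + δ)))) :=
    (convex_convexHull ℝ _).closure
  have hmem : ∀ s ∈ Icc (0 - δ) (0 + δ), ψ s ∈ convexHull ℝ (ψ '' Icc (0 - δ) (0 + δ)) :=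
    fun s hs => subset_convexHull ℝ _ (mem_image_of_mem ψ hs)
  have hnhds : Icc (0 - δ) (0 + δ) ∈ nhds (0 : ℝ) := Icc_mem_nhds (by linarith) (by linarith)
  have hl' := mem_closure_of_tendsto hl (eventually_of_mem (mem_nhdsWithin_of_mem_nhds hnhds) hmem)
  have hu' := mem_closure_of_tendsto hu (eventually_of_mem (mem_nhdsWithin_of_mem_nhds hnhds) hmem)
  exact hconv.ordConnected.out hl' hu' hw

lemma norm_le_euclNorm {m : ℕ} (x : Fin m → ℝ) : ‖x‖ ≤ euclNorm x := by
  refine (pi_norm_le_iff_of_nonneg (Real.sqrt_nonneg _)).2 fun i => ?_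
  rw [Real.norm_eq_abs]
  exact Real.abs_le_sqrt
    (Finset.single_le_sum (f := fun i => x i ^ 2) (fun j _ => sq_nonneg (x j)) (Finset.mem_univ i))

lemma euclNorm_nonneg {m : ℕ} (x : Fin m → ℝ) : 0 ≤ euclNorm x := Real.sqrt_nonneg _

lemma continuous_euclNorm {m : ℕ} : Continuous (euclNorm : (Fin m → ℝ) → ℝ) := by
  unfold euclNorm
  fun_prop

lemma exists_mulVec_bound {m k : ℕ} (M : Matrix (Fin m) (Fin k) ℝ) :
    ∃ K : ℝ, 0 ≤ K ∧ ∀ v, ‖M.mulVec v‖ ≤ K * ‖v‖ :=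
  ⟨‖LinearMap.toContinuousLinearMap M.mulVecLin‖, norm_nonneg _,
    fun v => (LinearMap.toContinuousLinearMap M.mulVecLin).le_opNorm v⟩

lemma exists_dotProduct_mulVec_bound {m k : ℕ} (M : Matrix (Fin m) (Fin k) ℝ) :
    ∃ K : ℝ, 0 ≤ K ∧ ∀ u v, |u ⬝ᵥ M.mulVec v| ≤ K * ‖u‖ * ‖v‖ := by
  obtain ⟨K, hK, hM⟩ := exists_mulVec_bound M
  refine ⟨m * K, by positivity, fun u v => ?_⟩
  calc |u ⬝ᵥ M.mulVec v| ≤ ∑ i, |u i * M.mulVec v i| := Finset.abs_sum_le_sum_abs _ _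
    _ ≤ ∑ _i : Fin m, ‖u‖ * (K * ‖v‖) := by
        refine Finset.sum_le_sum fun i _ => ?_
        rw [abs_mul]
        exact mul_le_mul (norm_le_pi_norm u i) ((norm_le_pi_norm _ i).trans (hM v))
          (abs_nonneg _) (norm_nonneg _)
    _ = m * K * ‖u‖ * ‖v‖ := by simp; ring

/-- A strictly positive quadratic form is coercive. -/
lemma exists_coercive_bound {m : ℕ} (M : Matrix (Fin m) (Fin m) ℝ)
    (hM : ∀ u, u ≠ 0 → 0 < u ⬝ᵥ M.mulVec u) :
    ∃ c : ℝ, 0 < c ∧ ∀ u, c * ‖u‖ ^ 2 ≤ u ⬝ᵥ M.mulVec u := by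
  rcases (Metric.sphere (0 : Fin m → ℝ) 1).eq_empty_or_nonempty with hS | hS
  · refine ⟨1, one_pos, fun u => ?_⟩
    by_cases hu : u = 0
    · simp [hu]
    · have : (‖u‖⁻¹ • u) ∈ Metric.sphere (0 : Fin m → ℝ) 1 := by
        simp [norm_smul, hu]
      simp [hS] at this
  · have hcont : Continuous fun u : Fin m → ℝ => u ⬝ᵥ M.mulVec u := by fun_prop
    obtain ⟨v, hv, hmin⟩ := (isCompact_sphere (0 : Fin m → ℝ) 1).exists_isMinOn hS
      hcont.continuousOn
    refine ⟨v ⬝ᵥ M.mulVec v, hM v (ne_zero_of_mem_unit_sphere ⟨v, hv⟩), fun u => ?_⟩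
    by_cases hu : u = 0
    · simp [hu]
    · have hn : 0 < ‖u‖ := norm_pos_iff.2 hu
      have h1 := hmin (show (‖u‖⁻¹ • u) ∈ Metric.sphere (0 : Fin m → ℝ) 1 by
        simp [norm_smul, hu])
      simp only [mem_ofPred_eq, mulVec_smul, smul_dotProduct, dotProduct_smul, smul_eq_mul] at h1
      calc _ ≤ (‖u‖⁻¹ * (‖u‖⁻¹ * (u ⬝ᵥ M.mulVec u))) * ‖u‖ ^ 2 := by gcongr
        _ = u ⬝ᵥ M.mulVec u := by field_simp

lemma LipschitzWith.comp_absolutelyContinuousOnInterval {g f : ℝ → ℝ} {K : NNReal} {a b : ℝ}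
    (hg : LipschitzWith K g) (hf : AbsolutelyContinuousOnInterval f a b) :
    AbsolutelyContinuousOnInterval (fun t => g (f t)) a b := by
  refine squeeze_zero (fun E => Finset.sum_nonneg fun i _ => dist_nonneg) (fun E => ?_)
    (by simpa using Tendsto.const_mul (K : ℝ) hf)
  rw [Finset.mul_sum]
  exact Finset.sum_le_sum fun i _ => hg.dist_le_mul _ _

lemma absolutelyContinuousOnInterval_sum {ι : Type*} (s : Finset ι) {f : ι → ℝ → ℝ} {a b : ℝ}
    (hf : ∀ i ∈ s, AbsolutelyContinuousOnInterval (f i) a b) :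
    AbsolutelyContinuousOnInterval (fun t => ∑ i ∈ s, f i t) a b := by
  induction s using Finset.cons_induction with
  | empty =>
    simpa using (LipschitzWith.const (0 : ℝ)).lipschitzOnWith.absolutelyContinuousOnInterval
  | cons i s hi ih =>
    simp only [Finset.sum_cons]
    exact (hf i (by simp)).add (ih fun j hj => hf j (by simp [hj]))

/-- The piecewise linear function with slope `hi` on the right and `lo` on the left of `0`. -/
def ramp (lo hi s : ℝ) : ℝ := max (hi * s) (lo * s)

/-- The slope of `ramp lo hi` at `s`, with the value `w` prescribed at the kink. -/
def rampSlope (lo hi w s : ℝ) : ℝ := if 0 < s then hi else if s < 0 then lo else w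

lemma exists_lipschitzWith_ramp (lo hi : ℝ) : ∃ K, LipschitzWith K (ramp lo hi) :=
  ⟨_, (lipschitzWith_smul hi).max (lipschitzWith_smul lo)⟩

lemma ramp_nonneg {lo hi : ℝ} (hlo : lo < 0) (hhi : 0 < hi) (s : ℝ) : 0 ≤ ramp lo hi s := by
  rcases le_total 0 s with hs | hs
  · exact le_max_of_le_left (mul_nonneg hhi.le hs)
  · exact le_max_of_le_right (mul_nonneg_of_nonpos_of_nonpos hlo.le hs)

lemma ramp_eq_zero {lo hi s : ℝ} (hlo : lo < 0) (hhi : 0 < hi) (h : ramp lo hi s = 0) :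
    s = 0 := by
  have h1 : hi * s ≤ 0 := h ▸ le_max_left _ _
  have h2 : lo * s ≤ 0 := h ▸ le_max_right _ _
  nlinarith

/-- Chain rule for the ramp, valid wherever the composition is differentiable. -/
lemma deriv_ramp_comp {lo hi w y' t : ℝ} {y : ℝ → ℝ} (hlo : lo < 0) (hhi : 0 < hi)
    (hy : HasDerivAt y y' t) (hd : DifferentiableAt ℝ (fun s => ramp lo hi (y s)) t) :
    deriv (fun s => ramp lo hi (y s)) t = rampSlope lo hi w (y t) * y' := by
  rcases lt_trichotomy (y t) 0 with h | h | h
  · have : (fun s => ramp lo hi (y s)) =ᶠ[nhds t] fun s => lo * y s := by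
      filter_upwards [hy.continuousAt.eventually_lt continuousAt_const h] with s hs
      exact max_eq_right (by nlinarith)
    rw [this.deriv_eq, (hy.const_mul lo).deriv]
    simp [rampSlope, h, h.le.not_gt]
  · have h0 : deriv (fun s => ramp lo hi (y s)) t = 0 := by
      refine IsLocalMin.deriv_eq_zero (Eventually.of_forall fun s => ?_)
      simpa [ramp, h] using ramp_nonneg hlo hhi (y s)
    have h1 : deriv (fun s => ramp lo hi (y s) - hi * y s) t = 0 := by
      refine IsLocalMin.deriv_eq_zero (Eventually.of_forall fun s => ?_)
      simp [ramp, h]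
    rw [(hd.hasDerivAt.fun_sub (hy.const_mul hi)).deriv, h0, zero_sub, neg_eq_zero,
      mul_eq_zero] at h1
    rw [h0, h1.resolve_left hhi.ne', mul_zero]
  · have : (fun s => ramp lo hi (y s)) =ᶠ[nhds t] fun s => hi * y s := by
      filter_upwards [continuousAt_const.eventually_lt hy.continuousAt h] with s hs
      exact max_eq_left (by nlinarith)
    rw [this.deriv_eq, (hy.const_mul hi).deriv]
    simp [rampSlope, h]

/-- A nonnegative absolutely continuous function decreasing at a uniform rate while nonzero
vanishes after a finite time. -/
lemma exists_forall_eq_zero_of_deriv_le {h : ℝ → ℝ} {c T₀ : ℝ} (hc : 0 < c)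
    (hnn : ∀ t, 0 ≤ h t)
    (hac : ∀ a b, T₀ ≤ a → a ≤ b → AbsolutelyContinuousOnInterval h a b)
    (hd : ∀ᵐ t, T₀ ≤ t → deriv h t ≤ 0 ∧ (h t ≠ 0 → deriv h t ≤ -c)) :
    ∃ T, T₀ ≤ T ∧ ∀ t, T ≤ t → h t = 0 := by
  have key : ∀ a b k, T₀ ≤ a → a ≤ b → (∀ᵐ t, t ∈ Icc a b → deriv h t ≤ k) →
      h b - h a ≤ k * (b - a) := by
    intro a b k ha hab hk
    rw [← (hac a b ha hab).integral_deriv_eq_sub]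
    calc _ ≤ ∫ _t in a..b, k := by
          refine intervalIntegral.integral_mono_ae_restrict hab
            (hac a b ha hab).intervalIntegrable_deriv intervalIntegrable_const ?_
          exact (ae_restrict_iff' measurableSet_Icc).2 hk
      _ = k * (b - a) := by simp [mul_comm]
  have hanti : ∀ a b, T₀ ≤ a → a ≤ b → h b ≤ h a := by
    intro a b ha hab
    have := key a b 0 ha hab (by
      filter_upwards [hd] with t ht hm using (ht (ha.trans hm.1)).1)
    linarith
  obtain ⟨T, hT, hT0⟩ : ∃ T, T₀ ≤ T ∧ h T = 0 := by
    by_contra! hne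
    have hle : T₀ ≤ T₀ + (h T₀ / c + 1) := by
      have := div_nonneg (hnn T₀) hc.le
      linarith
    have h1 := key T₀ _ (-c) le_rfl hle (by
      filter_upwards [hd] with t ht hm using (ht hm.1).2 (hne t hm.1))
    have h2 := hnn (T₀ + (h T₀ / c + 1))
    have h3 : -c * (T₀ + (h T₀ / c + 1) - T₀) = -h T₀ - c := by field_simp; ring
    linarith
  exact ⟨T, hT, fun t ht => le_antisymm (hT0 ▸ hanti T t hT ht) (hnn t)⟩

/-- Components of a linear output of a Krasovskii solution agree for nonnegative times with a
locally absolutely continuous function having the expected derivative. -/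
lemma exists_output_primitive {n p : ℕ} (C : Matrix (Fin p) (Fin n) ℝ) {x f : ℝ → Fin n → ℝ}
    (hf : ∀ t ∈ Ici (0 : ℝ), IntervalIntegrable f volume 0 t)
    (hx : ∀ t ∈ Ici (0 : ℝ), x t = x 0 + ∫ τ in (0:ℝ)..t, f τ) (i : Fin p) :
    ∃ y : ℝ → ℝ, (∀ t, 0 ≤ t → y t = C.mulVec (x t) i) ∧
      (∀ a b, 0 ≤ a → a ≤ b → AbsolutelyContinuousOnInterval y a b) ∧
      ∀ᵐ t, 0 ≤ t → HasDerivAt y (C.mulVec (f t) i) t := by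
  let φ : (Fin n → ℝ) →L[ℝ] ℝ :=
    LinearMap.toContinuousLinearMap ((LinearMap.proj i).comp C.mulVecLin)
  have hφ : ∀ v, φ v = C.mulVec v i := fun v => rfl
  have hφf : ∀ t, 0 ≤ t → IntervalIntegrable (fun τ => φ (f τ)) volume 0 t := fun t ht =>
    ⟨φ.integrable_comp (hf t ht).1, φ.integrable_comp (hf t ht).2⟩
  refine ⟨fun t => φ (x 0) + ∫ τ in (0:ℝ)..t, φ (f τ), fun t ht => ?_, fun a b ha hab => ?_, ?_⟩
  · change φ (x 0) + ∫ τ in (0:ℝ)..t, φ (f τ) = _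
    rw [φ.intervalIntegral_comp_comm (hf t ht), ← map_add, ← hx t ht, hφ]
  · have h1 := (hφf b (ha.trans hab)).absolutelyContinuousOnInterval_intervalIntegral
      (left_mem_uIcc)
    have h2 := (isometry_add_left (φ (x 0))).lipschitz.comp_absolutelyContinuousOnInterval h1
    exact h2.mono (by
      rw [uIcc_of_le hab, uIcc_of_le (ha.trans hab)]
      exact Icc_subset_Icc_left ha)
  · have h1 : ∀ N : ℕ, ∀ᵐ t, t ∈ uIcc (0 : ℝ) N → ∀ c ∈ uIcc (0 : ℝ) N,
        HasDerivAt (fun t => ∫ τ in c..t, φ (f τ)) (φ (f t)) t :=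
      fun N => (hφf N N.cast_nonneg).ae_hasDerivAt_integral
    filter_upwards [ae_all_iff.2 h1] with t ht h0
    obtain ⟨N, hN⟩ := exists_nat_ge t
    exact (ht N (by rw [uIcc_of_le (h0.trans hN)]; exact ⟨h0, hN⟩) 0 left_mem_uIcc).const_add _

lemma mulVec_mulVec_sub_mulVec {n p : ℕ} (A : Matrix (Fin n) (Fin n) ℝ)
    (B : Matrix (Fin n) (Fin p) ℝ) (C : Matrix (Fin p) (Fin n) ℝ) (x : Fin n → ℝ)
    (w : Fin p → ℝ) :
    C.mulVec (A.mulVec x - B.mulVec w) = (C * A).mulVec x - (C * B).mulVec w := by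
  rw [mulVec_sub, mulVec_mulVec, mulVec_mulVec]

lemma dotProduct_diagonal_mul_mulVec_pos {p : ℕ} {M : Matrix (Fin p) (Fin p) ℝ} {γ : Fin p → ℝ}
    (h : ∀ u : Fin p → ℝ, u ≠ 0 →
      0 < u ⬝ᵥ (Matrix.diagonal γ * M + Mᵀ * Matrix.diagonal γ).mulVec u)
    {u : Fin p → ℝ} (hu : u ≠ 0) : 0 < u ⬝ᵥ (Matrix.diagonal γ * M).mulVec u := by
  have h1 := h u hu
  have h2 : u ⬝ᵥ (Mᵀ * Matrix.diagonal γ).mulVec u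
      = u ⬝ᵥ (Matrix.diagonal γ * M).mulVec u := by
    rw [dotProduct_comm, ← vecMul_transpose, ← dotProduct_mulVec]
    simp
  rw [add_mulVec, dotProduct_add, h2] at h1
  linarith

lemma exists_pos_forall_le {p : ℕ} {a : Fin p → ℝ} (ha : ∀ i, 0 < a i) :
    ∃ m : ℝ, 0 < m ∧ ∀ i, m ≤ a i := by
  have h : ∀ᶠ m in nhdsWithin (0 : ℝ) (Ioi 0), ∀ i, m ≤ a i := eventually_all.2 fun i =>
    mem_nhdsWithin_of_mem_nhds (Iic_mem_nhds (ha i))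
  exact (eventually_mem_nhdsWithin.and h).exists

/-- Near the origin, the regularized nonlinearity is close to the corresponding one-sided limit. -/
lemma exists_kras_near_rampSlope {ψ : ℝ → ℝ} {lo hi η : ℝ} (hη : 0 < η)
    (hl : Tendsto ψ (nhdsWithin 0 (Iio 0)) (nhds lo))
    (hu : Tendsto ψ (nhdsWithin 0 (Ioi 0)) (nhds hi)) :
    ∃ δ : ℝ, 0 < δ ∧ ∀ y, |y| < δ → ∀ w ∈ kras ψ y, |w - rampSlope lo hi w y| ≤ η := by
  have hl' := hl.eventually (Icc_mem_nhds (sub_lt_self lo hη) (lt_add_of_pos_right lo hη))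
  have hu' := hu.eventually (Icc_mem_nhds (sub_lt_self hi hη) (lt_add_of_pos_right hi hη))
  obtain ⟨a, ha, hla⟩ := mem_nhdsLT_iff_exists_Ioo_subset.1 hl'
  obtain ⟨b, hb, hub⟩ := mem_nhdsGT_iff_exists_Ioo_subset.1 hu'
  have ha : a < 0 := ha
  have hb : 0 < b := hb
  refine ⟨min (-a) b, lt_min (by linarith) hb, fun y hy w hw => ?_⟩
  obtain ⟨hy1, hy2⟩ := abs_lt.1 hy
  rcases lt_trichotomy y 0 with h | h | h
  · have := kras_subset_Icc (fun s hs => hla hs)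
      (⟨by linarith [min_le_left (-a) b], h⟩ : y ∈ Ioo a 0) hw
    simp only [rampSlope, h, h.le.not_gt, if_true, if_false]
    exact abs_le.2 ⟨by linarith [this.1], by linarith [this.2]⟩
  · simp [rampSlope, h, hη.le]
  · have := kras_subset_Icc (fun s hs => hub hs)
      (⟨h, by linarith [min_le_right (-a) b]⟩ : y ∈ Ioo 0 b) hw
    simp only [rampSlope, h, if_true]
    exact abs_le.2 ⟨by linarith [this.1], by linarith [this.2]⟩

/-- Uniform decrease, near the origin, of the weighted sum of ramps along the output dynamics. -/
lemma exists_uniform_decrease {n p : ℕ} (A : Matrix (Fin n) (Fin n) ℝ)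
    (B : Matrix (Fin n) (Fin p) ℝ) (C : Matrix (Fin p) (Fin n) ℝ) {ψ : Fin p → ℝ → ℝ}
    {γ lo hi : Fin p → ℝ}
    (hpos : ∀ u : Fin p → ℝ, u ≠ 0 → 0 < u ⬝ᵥ (Matrix.diagonal γ * (C * B)).mulVec u)
    (hlo : ∀ i, lo i < 0) (hhi : ∀ i, 0 < hi i)
    (hl : ∀ i, Tendsto (ψ i) (nhdsWithin 0 (Iio 0)) (nhds (lo i)))
    (hu : ∀ i, Tendsto (ψ i) (nhdsWithin 0 (Ioi 0)) (nhds (hi i))) :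
    ∃ r c : ℝ, 0 < r ∧ 0 < c ∧ ∀ x : Fin n → ℝ, ‖x‖ < r → C.mulVec x ≠ 0 →
      ∀ w ∈ PsiSet ψ (C.mulVec x),
        ∑ i, γ i * (rampSlope (lo i) (hi i) (w i) (C.mulVec x i) *
          C.mulVec (A.mulVec x - B.mulVec w) i) ≤ -c := by
  obtain ⟨c₀, hc₀, hcoer⟩ := exists_coercive_bound _ hpos
  obtain ⟨K₁, hK₁, hb₁⟩ := exists_dotProduct_mulVec_bound (Matrix.diagonal γ * (C * A))
  obtain ⟨K₂, hK₂, hb₂⟩ := exists_dotProduct_mulVec_bound (Matrix.diagonal γ * (C * B))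
  obtain ⟨K₃, hK₃, hb₃⟩ := exists_mulVec_bound C
  obtain ⟨m, hm, hm'⟩ := exists_pos_forall_le
    (a := fun i => min (-lo i) (hi i)) fun i => lt_min (neg_pos.2 (hlo i)) (hhi i)
  set η := c₀ * m / (4 * (K₂ + 1)) with hη_def
  have hη : 0 < η := by positivity
  choose δ hδ hnear using fun i => exists_kras_near_rampSlope hη (hl i) (hu i)
  obtain ⟨d, hd, hd'⟩ := exists_pos_forall_le hδ
  refine ⟨min (d / (K₃ + 1)) (c₀ * m / (4 * (K₁ + 1))), c₀ * m ^ 2 / 2, by positivity,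
    by positivity, fun x hx hy w hw => ?_⟩
  have hx1 : ‖x‖ * (K₃ + 1) < d := (lt_div_iff₀ (by positivity)).1 (hx.trans_le (min_le_left _ _))
  have hx2 : ‖x‖ * (4 * (K₁ + 1)) < c₀ * m :=
    (lt_div_iff₀ (by positivity)).1 (hx.trans_le (min_le_right _ _))
  have hη2 : η * (4 * (K₂ + 1)) = c₀ * m := div_mul_cancel₀ _ (by positivity)
  set l : Fin p → ℝ := fun i => rampSlope (lo i) (hi i) (w i) (C.mulVec x i) with hl_def
  have hwl : ‖w - l‖ ≤ η := by
    refine (pi_norm_le_iff_of_nonneg hη.le).2 fun i => hnear i _ ?_ _ (hw i)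
    calc |C.mulVec x i| ≤ ‖C.mulVec x‖ := norm_le_pi_norm (C.mulVec x) i
      _ ≤ K₃ * ‖x‖ := hb₃ x
      _ ≤ ‖x‖ * (K₃ + 1) := by nlinarith [norm_nonneg x]
      _ < δ i := hx1.trans_le (hd' i)
  have hml : m ≤ ‖l‖ := by
    obtain ⟨i, hi0⟩ := Function.ne_iff.1 hy
    have h1 := (hm' i).trans (min_le_left _ _)
    have h2 := (hm' i).trans (min_le_right _ _)
    refine le_trans ?_ (norm_le_pi_norm l i)
    rw [Real.norm_eq_abs]
    rcases lt_or_gt_of_ne hi0 with h | h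
    · have h : C.mulVec x i < 0 := h
      have : l i = lo i := by simp [hl_def, rampSlope, h, h.le.not_gt]
      rw [this]
      exact h1.trans (neg_le_abs _)
    · have h : 0 < C.mulVec x i := h
      have : l i = hi i := by simp [hl_def, rampSlope, h]
      rw [this]
      exact h2.trans (le_abs_self _)
  have hsum : ∑ i, γ i * (l i * C.mulVec (A.mulVec x - B.mulVec w) i)
      = l ⬝ᵥ (Matrix.diagonal γ * (C * A)).mulVec x
        - l ⬝ᵥ (Matrix.diagonal γ * (C * B)).mulVec l
        - l ⬝ᵥ (Matrix.diagonal γ * (C * B)).mulVec (w - l) := by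
    have : l ⬝ᵥ (Matrix.diagonal γ).mulVec (C.mulVec (A.mulVec x - B.mulVec w))
        = ∑ i, γ i * (l i * C.mulVec (A.mulVec x - B.mulVec w) i) := by
      simp only [dotProduct, mulVec_diagonal]
      exact Finset.sum_congr rfl fun i _ => by ring
    rw [← this, mulVec_mulVec_sub_mulVec, mulVec_sub, dotProduct_sub, mulVec_mulVec, mulVec_mulVec,
      sub_sub, ← dotProduct_add, ← mulVec_add, add_sub_cancel]
  rw [hsum]
  have e1 := (le_abs_self _).trans (hb₁ l x)
  have e2 := (neg_le_abs _).trans (hb₂ l (w - l))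
  have e3 := hcoer l
  have hln := norm_nonneg l
  have e4 : K₁ * ‖l‖ * ‖x‖ ≤ ‖l‖ * (c₀ * m / 4) := by
    have : K₁ * ‖x‖ ≤ c₀ * m / 4 := by nlinarith [norm_nonneg x]
    nlinarith
  have e5 : K₂ * ‖l‖ * ‖w - l‖ ≤ ‖l‖ * (c₀ * m / 4) := by
    have h1 : K₂ * ‖w - l‖ ≤ K₂ * η := by gcongr
    have : K₂ * ‖w - l‖ ≤ c₀ * m / 4 := by nlinarith
    nlinarith
  have e6 : c₀ * m ^ 2 / 2 ≤ c₀ * ‖l‖ ^ 2 - ‖l‖ * (c₀ * m / 2) := by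
    have h1 : 0 ≤ c₀ * ((‖l‖ - m) * (‖l‖ + m / 2)) :=
      mul_nonneg hc₀.le (mul_nonneg (by linarith) (by linarith))
    nlinarith
  linarith

lemma timeItv_top : timeItv ⊤ = Ici 0 := by
  ext t
  simp [timeItv]

lemma stateFiniteTimeStable_of_ker_eq_bot {n p : ℕ} {A : Matrix (Fin n) (Fin n) ℝ}
    {B : Matrix (Fin n) (Fin p) ℝ} {C : Matrix (Fin p) (Fin n) ℝ} {ψ : Fin p → ℝ → ℝ}
    {γ lo hi : Fin p → ℝ} (hγ : ∀ i, 0 < γ i)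
    (hpos : ∀ u : Fin p → ℝ, u ≠ 0 → 0 < u ⬝ᵥ (Matrix.diagonal γ * (C * B)).mulVec u)
    (hGAS : GASOrigin A B C ψ) (hlo : ∀ i, lo i < 0) (hhi : ∀ i, 0 < hi i)
    (hl : ∀ i, Tendsto (ψ i) (nhdsWithin 0 (Iio 0)) (nhds (lo i)))
    (hu : ∀ i, Tendsto (ψ i) (nhdsWithin 0 (Ioi 0)) (nhds (hi i)))
    (hC : ∀ v : Fin n → ℝ, C.mulVec v = 0 → v = 0) (x : ℝ → Fin n → ℝ)
    (hx : IsKrasovskiiSolutionOn (lureF A B C ψ) x (Ici 0)) :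
    ∃ T : ℝ, 0 ≤ T ∧ ∀ t : ℝ, T ≤ t → x t = 0 := by
  obtain ⟨r, c, hr, hc, hdec⟩ := exists_uniform_decrease A B C hpos hlo hhi hl hu
  obtain ⟨β, hβ, hbound⟩ := hGAS
  have hxβ : ∀ t, 0 ≤ t → euclNorm (x t) ≤ β (euclNorm (x 0)) t := fun t ht =>
    hbound ⊤ x (timeItv_top ▸ hx) t (timeItv_top ▸ ht)
  obtain ⟨T₀, hT₀⟩ := eventually_atTop.1
    (((hβ.2 _ (euclNorm_nonneg (x 0))).2.eventually (gt_mem_nhds hr)).and (eventually_ge_atTop 0))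
  have hT₀0 : 0 ≤ T₀ := (hT₀ T₀ le_rfl).2
  have hsmall : ∀ t, T₀ ≤ t → ‖x t‖ < r := fun t ht =>
    ((norm_le_euclNorm _).trans (hxβ t (hT₀0.trans ht))).trans_lt (hT₀ t ht).1
  obtain ⟨f, hfi, hfF, hxf⟩ := hx
  choose y hy hyac hyd using exists_output_primitive C hfi hxf
  have hrac : ∀ i a b, 0 ≤ a → a ≤ b →
      AbsolutelyContinuousOnInterval (fun t => ramp (lo i) (hi i) (y i t)) a b :=
    fun i a b ha hab =>
      (exists_lipschitzWith_ramp _ _).choose_spec.comp_absolutelyContinuousOnInterval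
        (hyac i a b ha hab)
  have hrd : ∀ᵐ t, ∀ i, 0 ≤ t →
      DifferentiableAt ℝ (fun t => ramp (lo i) (hi i) (y i t)) t := by
    refine ae_all_iff.2 fun i => ?_
    filter_upwards [ae_all_iff.2 fun N : ℕ =>
      (hrac i 0 N le_rfl N.cast_nonneg).ae_differentiableAt] with t ht h0
    obtain ⟨N, hN⟩ := exists_nat_ge t
    exact ht N (by rw [uIcc_of_le (h0.trans hN)]; exact ⟨h0, hN⟩)
  have hterm : ∀ i t, 0 ≤ γ i * ramp (lo i) (hi i) (y i t) := fun i t =>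
    mul_nonneg (hγ i).le (ramp_nonneg (hlo i) (hhi i) _)
  have hzero : ∀ t, 0 ≤ t → (∑ i, γ i * ramp (lo i) (hi i) (y i t) = 0 ↔ x t = 0) := by
    intro t ht
    rw [Finset.sum_eq_zero_iff_of_nonneg fun i _ => hterm i t]
    constructor
    · refine fun h => hC _ (funext fun i => ?_)
      rw [← hy i t ht]
      exact ramp_eq_zero (hlo i) (hhi i)
        ((mul_eq_zero.1 (h i (Finset.mem_univ i))).resolve_left (hγ i).ne')
    · intro h i _
      simp [hy i t ht, h, ramp]
  obtain ⟨T, hT, hT'⟩ := exists_forall_eq_zero_of_deriv_le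
    (h := fun t => ∑ i, γ i * ramp (lo i) (hi i) (y i t)) (T₀ := T₀) hc
    (fun t => Finset.sum_nonneg fun i _ => hterm i t)
    (fun a b ha hab => absolutelyContinuousOnInterval_sum _ fun i _ =>
      (hrac i a b (hT₀0.trans ha) hab).const_mul _) (by
      filter_upwards [hrd, ae_all_iff.2 hyd, hfF] with t hd hyt hft ht
      have ht0 : 0 ≤ t := hT₀0.trans ht
      obtain ⟨u, hu, hfu⟩ := hft ht0
      have hsum : deriv (fun t => ∑ i, γ i * ramp (lo i) (hi i) (y i t)) t
          = ∑ i, γ i * (rampSlope (lo i) (hi i) (-u i) (C.mulVec (x t) i) *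
            C.mulVec (A.mulVec (x t) - B.mulVec (fun i => -u i)) i) := by
        rw [deriv_fun_sum fun i _ => (hd i ht0).const_mul _]
        refine Finset.sum_congr rfl fun i _ => ?_
        rw [deriv_const_mul _ (hd i ht0),
          deriv_ramp_comp (w := -u i) (hlo i) (hhi i) (hyt i ht0) (hd i ht0), hy i t ht0, hfu]
        have : (fun i => -u i) = -u := rfl
        rw [this, mulVec_neg, sub_neg_eq_add]
      have hneg : x t ≠ 0 → deriv (fun t => ∑ i, γ i * ramp (lo i) (hi i) (y i t)) t ≤ -c :=
        fun h => hsum ▸ hdec (x t) (hsmall t ht) (fun h' => h (hC _ h')) _ hu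
      refine ⟨?_, fun h => hneg fun h' => h ((hzero t ht0).2 h')⟩
      by_cases h : x t = 0
      · refine le_of_eq (IsLocalMin.deriv_eq_zero (Eventually.of_forall fun s => ?_))
        change ∑ i, γ i * ramp (lo i) (hi i) (y i t) ≤ _
        rw [(hzero t ht0).2 h]
        exact Finset.sum_nonneg fun i _ => hterm i s
      · exact (hneg h).trans (neg_nonpos.2 hc.le))
  exact ⟨T, hT₀0.trans hT, fun t ht => (hzero t (hT₀0.trans (hT.trans ht))).1 (hT' t ht)⟩

/-- The linear flow generated by a continuous linear map. -/
def linearFlow {E : Type*} [NormedAddCommGroup E] [NormedSpace ℝ E] (L : E →L[ℝ] E) (v : E)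
    (t : ℝ) : E :=
  NormedSpace.exp (t • L) v

section linearFlow

variable {E : Type*} [NormedAddCommGroup E] [NormedSpace ℝ E] (L : E →L[ℝ] E) (v : E)

lemma linearFlow_zero : linearFlow L v 0 = v := by
  simp [linearFlow]

variable [CompleteSpace E]

lemma hasDerivAt_linearFlow (t : ℝ) : HasDerivAt (linearFlow L v) (L (linearFlow L v t)) t :=
  ((ContinuousLinearMap.apply ℝ E v).hasFDerivAt.comp_hasDerivAt t
    (hasDerivAt_exp_smul_const' L t) :)

lemma continuous_linearFlow : Continuous (linearFlow L v) :=
  continuous_iff_continuousAt.2 fun t => (hasDerivAt_linearFlow L v t).continuousAt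

variable {v} in
lemma linearFlow_ne_zero (hv : v ≠ 0) (t : ℝ) : linearFlow L v t ≠ 0 := by
  intro h
  let _ : NormedAlgebra ℚ (E →L[ℝ] E) := NormedAlgebra.restrictScalars ℚ ℝ _
  have hu : NormedSpace.exp (-(t • L)) * NormedSpace.exp (t • L) = (1 : E →L[ℝ] E) := by
    rw [← NormedSpace.exp_add_of_commute (Commute.refl (t • L)).neg_left, neg_add_cancel,
      NormedSpace.exp_zero]
  have := congrArg (fun M : E →L[ℝ] E => M v) hu
  simp only [mul_apply_eq_comp] at this
  change NormedSpace.exp (-(t • L)) (linearFlow L v t) = v at this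
  rw [h, map_zero] at this
  exact hv this.symm

/-- The flow stays in the kernel of any linear map annihilating the generator. -/
lemma map_linearFlow_eq_zero {G : Type*} [NormedAddCommGroup G] [NormedSpace ℝ G]
    {P : E →L[ℝ] G} (hP : ∀ w, P (L w) = 0) (hv : P v = 0) (t : ℝ) :
    P (linearFlow L v t) = 0 := by
  have hd : ∀ s, HasDerivAt (fun s => P (linearFlow L v s)) 0 s := fun s =>
    hP (linearFlow L v s) ▸ P.hasFDerivAt.comp_hasDerivAt s (hasDerivAt_linearFlow L v s)
  have := is_const_of_deriv_eq_zero (fun s => (hd s).differentiableAt) (fun s => (hd s).deriv) t 0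
  simpa [linearFlow_zero, hv] using this

lemma intervalIntegrable_linearFlow (a b : ℝ) :
    IntervalIntegrable (fun t => L (linearFlow L v t)) volume a b :=
  (L.continuous.comp (continuous_linearFlow L v)).intervalIntegrable a b

lemma linearFlow_eq_add_integral (t : ℝ) :
    linearFlow L v t = linearFlow L v 0 + ∫ τ in (0:ℝ)..t, L (linearFlow L v τ) := by
  rw [intervalIntegral.integral_eq_sub_of_hasDerivAt
    (fun s _ => hasDerivAt_linearFlow L v s) (intervalIntegrable_linearFlow L v 0 t),
    add_sub_cancel]

end linearFlow

/-- A continuous curve bounded by `ρ < r` as long as it stays in the ball of radius `r` never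
leaves that ball. -/
lemma norm_lt_of_bootstrap {E : Type*} [NormedAddCommGroup E] {x : ℝ → E} {ρ r : ℝ}
    (hx : Continuous x) (h0 : ‖x 0‖ < r) (hρ : ρ < r)
    (hb : ∀ T, (∀ t, 0 ≤ t → t < T → ‖x t‖ < r) → ∀ t, 0 ≤ t → t < T → ‖x t‖ ≤ ρ) :
    ∀ t, 0 ≤ t → ‖x t‖ < r := by
  by_contra! hex
  set S : Set ℝ := {t | 0 ≤ t ∧ r ≤ ‖x t‖} with hS
  have hclosed : IsClosed S :=
    isClosed_Ici.inter (isClosed_Ici.preimage hx.norm)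
  have hbdd : BddBelow S := ⟨0, fun t ht => ht.1⟩
  obtain ⟨hT0, hTr⟩ : sInf S ∈ S := hclosed.csInf_mem hex hbdd
  have hTpos : 0 < sInf S := lt_of_le_of_ne hT0 fun h => by rw [← h] at hTr; linarith
  have hle := hb (sInf S) fun t ht htT => by
    by_contra! h
    exact htT.not_ge (csInf_le hbdd ⟨ht, h⟩)
  have hlim : Tendsto (fun t => ‖x t‖) (nhdsWithin (sInf S) (Iio (sInf S)))
      (nhds ‖x (sInf S)‖) := hx.norm.continuousAt.tendsto.mono_left nhdsWithin_le_nhds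
  have : ‖x (sInf S)‖ ≤ ρ := le_of_tendsto hlim (by
    filter_upwards [Ioo_mem_nhdsLT hTpos] with t ht using hle t ht.1.le ht.2)
  linarith

lemma ker_eq_bot_of_stateFiniteTimeStable {n p : ℕ} {A : Matrix (Fin n) (Fin n) ℝ}
    {B : Matrix (Fin n) (Fin p) ℝ} {C : Matrix (Fin p) (Fin n) ℝ} {ψ : Fin p → ℝ → ℝ}
    {γ lo hi : Fin p → ℝ}
    (hpos : ∀ u : Fin p → ℝ, u ≠ 0 → 0 < u ⬝ᵥ (Matrix.diagonal γ * (C * B)).mulVec u)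
    (hGAS : GASOrigin A B C ψ) (hlo : ∀ i, lo i < 0) (hhi : ∀ i, 0 < hi i)
    (hl : ∀ i, Tendsto (ψ i) (nhdsWithin 0 (Iio 0)) (nhds (lo i)))
    (hu : ∀ i, Tendsto (ψ i) (nhdsWithin 0 (Ioi 0)) (nhds (hi i)))
    (hfts : ∀ x : ℝ → Fin n → ℝ, IsKrasovskiiSolutionOn (lureF A B C ψ) x (Ici 0) →
      ∃ T : ℝ, 0 ≤ T ∧ ∀ t : ℝ, T ≤ t → x t = 0)
    (v : Fin n → ℝ) (hv : C.mulVec v = 0) : v = 0 := by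
  by_contra hv0
  have hunit : IsUnit (C * B) := by
    refine mulVec_injective_iff_isUnit.1
      ((injective_iff_map_eq_zero (C * B).mulVecLin).2 fun u hu => ?_)
    by_contra hu0
    have := hpos u hu0
    rw [← mulVec_mulVec, show (C * B).mulVec u = 0 from hu] at this
    simp at this
  set G : Matrix (Fin p) (Fin n) ℝ := (C * B)⁻¹ * (C * A) with hG
  have hCBG : C * B * G = C * A := by
    rw [hG, ← Matrix.mul_assoc, mul_nonsing_inv _ ((isUnit_iff_isUnit_det _).1 hunit),
      Matrix.one_mul]
  let L : (Fin n → ℝ) →L[ℝ] (Fin n → ℝ) := LinearMap.toContinuousLinearMap (A - B * G).mulVecLin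
  let P : (Fin n → ℝ) →L[ℝ] (Fin p → ℝ) := LinearMap.toContinuousLinearMap C.mulVecLin
  have hPL : ∀ w, P (L w) = 0 := by
    intro w
    change C.mulVec ((A - B * G).mulVec w) = 0
    rw [mulVec_mulVec, Matrix.mul_sub, ← Matrix.mul_assoc, hCBG, sub_self, zero_mulVec]
  obtain ⟨K, hK, hGK⟩ := exists_mulVec_bound G
  obtain ⟨m, hm, hm'⟩ := exists_pos_forall_le
    (a := fun i => min (-lo i) (hi i)) fun i => lt_min (neg_pos.2 (hlo i)) (hhi i)
  set r := m / (K + 1) with hr_def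
  have hr : 0 < r := by positivity
  have hF : ∀ x : Fin n → ℝ, ‖x‖ < r → C.mulVec x = 0 → L x ∈ lureF A B C ψ x := by
    intro x hx hCx
    refine ⟨-G.mulVec x, fun i => ?_, ?_⟩
    · rw [hCx]
      refine Icc_subset_kras_zero (hl i) (hu i) ?_
      have h1 : |G.mulVec x i| ≤ m := by
        calc |G.mulVec x i| ≤ ‖G.mulVec x‖ := norm_le_pi_norm (G.mulVec x) i
          _ ≤ K * ‖x‖ := hGK x
          _ ≤ ‖x‖ * (K + 1) := by nlinarith [norm_nonneg x]
          _ ≤ m := ((lt_div_iff₀ (by positivity)).1 hx).le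
      have h2 := (hm' i).trans (min_le_left _ _)
      have h3 := (hm' i).trans (min_le_right _ _)
      obtain ⟨h4, h5⟩ := abs_le.1 h1
      simp only [Pi.neg_apply, neg_neg]
      exact ⟨by linarith, by linarith⟩
    · change (A - B * G).mulVec x = _
      rw [sub_mulVec, mulVec_neg, mulVec_mulVec, sub_eq_add_neg]
  obtain ⟨β, hβ, hbound⟩ := hGAS
  obtain ⟨ε, hε, hεr, hεβ⟩ : ∃ ε : ℝ, 0 < ε ∧ ‖ε • v‖ < r ∧ β (euclNorm (ε • v)) 0 < r := by
    have hc1 : Continuous fun ε : ℝ => ‖ε • v‖ := by fun_prop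
    have hc2 : Continuous fun ε : ℝ => euclNorm (ε • v) :=
      continuous_euclNorm.comp (by fun_prop)
    have hz : euclNorm ((0 : ℝ) • v) = 0 := by simp [euclNorm]
    have hβ0 : Tendsto (fun s => β s 0) (nhdsWithin 0 (Ici 0)) (nhds 0) := by
      have := (hβ.1 0 le_rfl).1 0 self_mem_Ici
      rwa [ContinuousWithinAt, (hβ.1 0 le_rfl).2.2] at this
    have ht2 : Tendsto (fun ε : ℝ => euclNorm (ε • v)) (nhds 0) (nhdsWithin 0 (Ici 0)) :=
      tendsto_nhdsWithin_iff.2 ⟨hc2.tendsto' 0 0 hz,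
        Eventually.of_forall fun ε => euclNorm_nonneg _⟩
    have e1 : ∀ᶠ ε : ℝ in nhds 0, ‖ε • v‖ < r :=
      hc1.continuousAt.eventually_lt continuousAt_const (by simpa using hr)
    have e2 : ∀ᶠ ε : ℝ in nhds 0, β (euclNorm (ε • v)) 0 < r :=
      (hβ0.comp ht2).eventually (gt_mem_nhds hr)
    exact (eventually_mem_nhdsWithin.and
      (nhdsWithin_le_nhds (s := Ioi 0) (e1.and e2))).exists
  set x := linearFlow L (ε • v) with hx
  have hx0 : x 0 = ε • v := linearFlow_zero _ _
  have hCx : ∀ t, C.mulVec (x t) = 0 := map_linearFlow_eq_zero L (ε • v) hPL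
    (by change C.mulVec (ε • v) = 0; rw [mulVec_smul, hv, smul_zero])
  have hsol : ∀ s : Set ℝ, (∀ t ∈ s, ‖x t‖ < r) →
      IsKrasovskiiSolutionOn (lureF A B C ψ) x s := fun s hs =>
    ⟨fun t => L (x t), fun t _ => intervalIntegrable_linearFlow _ _ _ _,
      Eventually.of_forall fun t ht => hF _ (hs t ht) (hCx t),
      fun t _ => linearFlow_eq_add_integral _ _ _⟩
  have hball : ∀ t, 0 ≤ t → ‖x t‖ < r := by
    refine norm_lt_of_bootstrap (continuous_linearFlow _ _) (hx0 ▸ hεr) hεβ fun T hT t ht htT => ?_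
    have hmem : ∀ s ∈ timeItv (ENNReal.ofReal T), 0 ≤ s ∧ s < T := fun s hs =>
      ⟨hs.1, (ENNReal.ofReal_lt_ofReal_iff_of_nonneg hs.1).1 hs.2⟩
    have hb := hbound (ENNReal.ofReal T) x
      (hsol _ fun s hs => hT s (hmem s hs).1 (hmem s hs).2) t
      ⟨ht, (ENNReal.ofReal_lt_ofReal_iff_of_nonneg ht).2 htT⟩
    rw [hx0] at hb
    exact (norm_le_euclNorm _).trans
      (hb.trans ((hβ.2 _ (euclNorm_nonneg _)).1 self_mem_Ici ht ht))
  obtain ⟨T, -, hT⟩ := hfts x (hsol _ hball)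
  exact linearFlow_ne_zero L (smul_ne_zero hε.ne' hv0) T (hT T le_rfl)

/-- under Assumptions 1 and 3, state finite-time stability of the
regularized Lur'e system is equivalent to `ker C = {0}`. -/
theorem stmt9 {n p : ℕ} (A : Matrix (Fin n) (Fin n) ℝ) (B : Matrix (Fin n) (Fin p) ℝ)
    (C : Matrix (Fin p) (Fin n) ℝ) (ψ : Fin p → ℝ → ℝ)
    -- Assumption 1
    (hA1 : ∀ i, PiecewiseContinuous (ψ i) ∧ ∃ z : ℝ, Sector (ψ i) z)
    -- Assumption 3 (i): CB is Lyapunov diagonally stable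
    (hLDS : ∃ γb : Fin p → ℝ, (∀ i, 0 < γb i) ∧
      ∀ u : Fin p → ℝ, u ≠ 0 →
        0 < u ⬝ᵥ ((Matrix.diagonal γb * (C * B) + (C * B)ᵀ * Matrix.diagonal γb).mulVec u))
    -- Assumption 3 (ii): the origin is GAS
    (hGAS : GASOrigin A B C ψ)
    -- Assumption 3 (iii): discontinuity at the origin with sign-definite limits
    (hdisc : ∀ i, ¬ ContinuousAt (ψ i) 0 ∧
      (∃ L : ℝ, 0 < L ∧ Tendsto (ψ i) (nhdsWithin 0 (Set.Ioi 0)) (nhds L)) ∧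
      (∃ L : ℝ, L < 0 ∧ Tendsto (ψ i) (nhdsWithin 0 (Set.Iio 0)) (nhds L))) :
    (∀ v : Fin n → ℝ, C.mulVec v = 0 → v = 0) ↔
      (∀ x : ℝ → Fin n → ℝ,
        IsKrasovskiiSolutionOn (lureF A B C ψ) x (Set.Ici 0) →
        ∃ T : ℝ, 0 ≤ T ∧ ∀ t : ℝ, T ≤ t → x t = 0) := by
  obtain ⟨γ, hγ, hLDS⟩ := hLDS
  choose hi hhi hu using fun i => (hdisc i).2.1
  choose lo hlo hl using fun i => (hdisc i).2.2
  have hpos : ∀ u : Fin p → ℝ, u ≠ 0 → 0 < u ⬝ᵥ (Matrix.diagonal γ * (C * B)).mulVec u :=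
    fun u hu => dotProduct_diagonal_mul_mulVec_pos hLDS hu
  exact ⟨stateFiniteTimeStable_of_ker_eq_bot hγ hpos hGAS hlo hhi hl hu,
    ker_eq_bot_of_stateFiniteTimeStable hpos hGAS hlo hhi hl hu⟩
end
end

section
/- Let ψ₁,…,ψ_p : ℝ → ℝ be piecewise continuous, each discontinuous at 0 with lim_{s→0⁺} ψᵢ(s) > 0 and lim_{s→0⁻} ψᵢ(s) < 0. Then there exist ν > 0 and c > 0 such that for every y ∈ ℝᵖ with 0 < |y| ≤ ν and every u ∈ −ΨΨ(y), one has |u| ≥ c. -/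
open Matrix MeasureTheory Filter Set
open scoped ENNReal

noncomputable section

/-- A closed convex set containing the values of `ψ` near `y` contains `kras ψ y`. -/
theorem kras_subset {ψ : ℝ → ℝ} {y δ : ℝ} {K : Set ℝ} (hδ : 0 < δ) (hconv : Convex ℝ K)
    (hclosed : IsClosed K) (hK : ∀ s ∈ Set.Icc (y - δ) (y + δ), ψ s ∈ K) : kras ψ y ⊆ K := by
  intro w hw
  refine closure_minimal (convexHull_min ?_ hconv) hclosed (Set.mem_iInter₂.1 hw δ hδ)
  rintro _ ⟨s, hs, rfl⟩
  exact hK s hs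

theorem eventually_le_kras_of_tendsto_right {ψ : ℝ → ℝ} {L : ℝ} (hL : 0 < L)
    (h : Tendsto ψ (nhdsWithin 0 (Set.Ioi 0)) (nhds L)) :
    ∀ᶠ r in nhdsWithin (0 : ℝ) (Set.Ioi 0),
      ∀ s, 0 < s → s ≤ r → ∀ w ∈ kras ψ s, r ≤ w := by
  obtain ⟨ε, hε, hψ⟩ := mem_nhdsGT_iff_exists_Ioo_subset.1
    (h.eventually (lt_mem_nhds (half_lt_self hL)))
  have hε0 : (0 : ℝ) < ε := hε
  filter_upwards [Ioo_mem_nhdsGT (half_pos hε0), Ioo_mem_nhdsGT (half_pos hL)]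
    with r hrε hrL s hs hsr w hw
  have hmem : w ∈ Set.Ici (L / 2) := by
    refine kras_subset (half_pos hs) (convex_Ici _) isClosed_Ici (fun t ht => ?_) hw
    have ht' : t ∈ Set.Ioo 0 ε := ⟨by linarith [ht.1], by linarith [ht.2, hrε.2]⟩
    have hlt : L / 2 < ψ t := hψ ht'
    exact hlt.le
  exact hrL.2.le.trans hmem

theorem eventually_kras_le_of_tendsto_left {ψ : ℝ → ℝ} {L : ℝ} (hL : L < 0)
    (h : Tendsto ψ (nhdsWithin 0 (Set.Iio 0)) (nhds L)) :
    ∀ᶠ r in nhdsWithin (0 : ℝ) (Set.Ioi 0),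
      ∀ s, s < 0 → -r ≤ s → ∀ w ∈ kras ψ s, w ≤ -r := by
  obtain ⟨ε, hε, hψ⟩ := mem_nhdsLT_iff_exists_Ioo_subset.1
    (h.eventually (gt_mem_nhds (show L < L / 2 by linarith)))
  have hε0 : ε < 0 := hε
  filter_upwards [Ioo_mem_nhdsGT (show 0 < -ε / 2 by linarith),
    Ioo_mem_nhdsGT (show 0 < -L / 2 by linarith)] with r hrε hrL s hs hsr w hw
  have hmem : w ∈ Set.Iic (L / 2) := by
    refine kras_subset (show 0 < -s / 2 by linarith) (convex_Iic _) isClosed_Iic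
      (fun t ht => ?_) hw
    have ht' : t ∈ Set.Ioo ε 0 := ⟨by linarith [ht.1, hrε.2], by linarith [ht.2]⟩
    have hlt : ψ t < L / 2 := hψ ht'
    exact hlt.le
  have : w ≤ L / 2 := hmem
  linarith [hrL.2]

theorem abs_le_euclNorm {m : ℕ} (x : Fin m → ℝ) (i : Fin m) : |x i| ≤ euclNorm x :=
  Real.abs_le_sqrt
    (Finset.single_le_sum (f := fun j => x j ^ 2) (fun j _ => sq_nonneg (x j)) (Finset.mem_univ i))

theorem exists_ne_zero_of_euclNorm_pos {m : ℕ} {x : Fin m → ℝ} (hx : 0 < euclNorm x) :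
    ∃ i, x i ≠ 0 := by
  by_contra! h
  simp [euclNorm, h] at hx

/-- Lemma 3: if each `ψᵢ` is piecewise continuous and
discontinuous at `0` with positive right limit and negative left limit, then
there exist `ν > 0` and `c > 0` such that `|u| ≥ c` for every `u ∈ -ΨΨ(y)`
whenever `0 < |y| ≤ ν`. -/
theorem stmt10 {p : ℕ} (ψ : Fin p → ℝ → ℝ)
    (hpc : ∀ i, PiecewiseContinuous (ψ i))
    (hdisc : ∀ i, ¬ ContinuousAt (ψ i) 0 ∧
      (∃ L : ℝ, 0 < L ∧ Tendsto (ψ i) (nhdsWithin 0 (Set.Ioi 0)) (nhds L)) ∧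
      (∃ L : ℝ, L < 0 ∧ Tendsto (ψ i) (nhdsWithin 0 (Set.Iio 0)) (nhds L))) :
    ∃ ν : ℝ, 0 < ν ∧ ∃ c : ℝ, 0 < c ∧
      ∀ y : Fin p → ℝ, 0 < euclNorm y → euclNorm y ≤ ν →
        ∀ u : Fin p → ℝ, (fun i => -u i) ∈ PsiSet ψ y → c ≤ euclNorm u := by
  have hev : ∀ᶠ r in nhdsWithin (0 : ℝ) (Set.Ioi 0), ∀ i,
      (∀ s, 0 < s → s ≤ r → ∀ w ∈ kras (ψ i) s, r ≤ w) ∧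
      (∀ s, s < 0 → -r ≤ s → ∀ w ∈ kras (ψ i) s, w ≤ -r) := by
    refine eventually_all.2 fun i => ?_
    obtain ⟨-, ⟨L, hL, hLt⟩, ⟨M, hM, hMt⟩⟩ := hdisc i
    exact (eventually_le_kras_of_tendsto_right hL hLt).and
      (eventually_kras_le_of_tendsto_left hM hMt)
  obtain ⟨r, hr, hr0⟩ := (hev.and self_mem_nhdsWithin).exists
  refine ⟨r, hr0, r, hr0, fun y hy0 hyr u hu => ?_⟩
  obtain ⟨i, hi⟩ := exists_ne_zero_of_euclNorm_pos hy0
  have hyi := abs_le.1 ((abs_le_euclNorm y i).trans hyr)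
  refine le_trans ?_ (abs_le_euclNorm u i)
  rcases hi.lt_or_gt with hneg | hpos
  · have := (hr i).2 _ hneg hyi.1 _ (hu i)
    exact le_abs.2 (Or.inl (by linarith))
  · exact le_abs.2 (Or.inr ((hr i).1 _ hpos hyi.2 _ (hu i)))
end
end
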